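/- Let 𝒳 be a nonempty subset of the cube [0,1]^E. Then the function F(y) := inf_{x ∈ 𝒳} I(y;x) is concave on the nonnegative orthant {y : S → ℝ : y ≥ 0}. -/

import Mathlib

open scoped BigOperators

/-- The expected influence `I(y;x)` for channels `S`, people `T`, edge set `E`,
budgets `y` and failure probabilities `x`; powers are real powers (`0^0 = 1`). -/
noncomputable def influence {S T : Type*} [Fintype T] [DecidableEq T]
    (E : Finset (S × T)) (y : S → ℝ) (x : S × T → ℝ) : ℝ :=
  ∑ t : T, (1 - ∏ e ∈ E.filter (fun e => e.2 = t), x e ^ y e.1)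

/-- A product of real powers of nonnegative bases is convex in the nonnegative exponents. -/
theorem convexOn_prod_rpow {ι S : Type*} (A : Finset ι) (f : ι → S) (x : ι → ℝ)
    (hx : ∀ i ∈ A, 0 ≤ x i) :
    ConvexOn ℝ {y : S → ℝ | ∀ s, 0 ≤ y s} (fun y => ∏ i ∈ A, x i ^ y (f i)) := by
  refine ⟨convex_Ici (0 : S → ℝ), ?_⟩
  intro y hy z hz a b ha hb hab
  have hprod : ∏ i ∈ A, x i ^ (a • y + b • z) (f i) =
      (∏ i ∈ A, x i ^ y (f i)) ^ a * (∏ i ∈ A, x i ^ z (f i)) ^ b := by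
    rw [← Real.finsetProd_rpow _ _ (fun i hi => Real.rpow_nonneg (hx i hi) _),
      ← Real.finsetProd_rpow _ _ (fun i hi => Real.rpow_nonneg (hx i hi) _),
      ← Finset.prod_mul_distrib]
    refine Finset.prod_congr rfl fun i hi => ?_
    rw [← Real.rpow_mul (hx i hi), ← Real.rpow_mul (hx i hi),
      ← Real.rpow_add_of_nonneg (hx i hi) (mul_nonneg (hy _) ha) (mul_nonneg (hz _) hb)]
    simp [mul_comm]
  change ∏ i ∈ A, x i ^ (a • y + b • z) (f i) ≤ _
  rw [hprod]
  exact Real.geom_mean_le_arith_mean2_weighted ha hb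
    (Finset.prod_nonneg fun i hi => Real.rpow_nonneg (hx i hi) _)
    (Finset.prod_nonneg fun i hi => Real.rpow_nonneg (hx i hi) _) hab

theorem influence_nonneg {S T : Type*} [Fintype T] [DecidableEq T] {E : Finset (S × T)}
    {y : S → ℝ} {x : S × T → ℝ} (hy : ∀ s, 0 ≤ y s) (hx : ∀ e ∈ E, 0 ≤ x e ∧ x e ≤ 1) :
    0 ≤ influence E y x := by
  refine Finset.sum_nonneg fun t _ => sub_nonneg.2 (Finset.prod_le_one ?_ ?_)
  · exact fun e he => Real.rpow_nonneg (hx e (Finset.mem_filter.1 he).1).1 _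
  · intro e he
    have h := hx e (Finset.mem_filter.1 he).1
    exact Real.rpow_le_one h.1 h.2 (hy _)

theorem concaveOn_influence {S T : Type*} [Fintype T] [DecidableEq T] {E : Finset (S × T)}
    {x : S × T → ℝ} (hx : ∀ e ∈ E, 0 ≤ x e) :
    ConcaveOn ℝ {y : S → ℝ | ∀ s, 0 ≤ y s} (fun y => influence E y x) := by
  refine ⟨convex_Ici (0 : S → ℝ), ?_⟩
  intro y hy z hz a b ha hb hab
  simp only [influence, Finset.smul_sum, ← Finset.sum_add_distrib]
  refine Finset.sum_le_sum fun t _ => ?_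
  have h := (convexOn_prod_rpow (E.filter (fun e => e.2 = t)) Prod.fst x
    (fun e he => hx e (Finset.mem_filter.1 he).1)).2 hy hz ha hb hab
  simp only [smul_eq_mul] at h ⊢
  linarith

/-- for a nonempty uncertainty set `𝒳 ⊆ [0,1]^E`, the worst-case
influence `F(y) = inf_{x ∈ 𝒳} I(y;x)` is concave on the nonnegative orthant. -/
theorem worst_case_influence_concave {S T : Type*} [Fintype S] [Fintype T] [DecidableEq T]
    (E : Finset (S × T)) (𝒳 : Set (S × T → ℝ)) (h𝒳ne : 𝒳.Nonempty)
    (h𝒳 : ∀ x ∈ 𝒳, ∀ e ∈ E, 0 ≤ x e ∧ x e ≤ 1) :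
    ConcaveOn ℝ {y : S → ℝ | ∀ s, 0 ≤ y s}
      (fun y => ⨅ x : 𝒳, influence E y (x : S × T → ℝ)) := by
  have : Nonempty 𝒳 := h𝒳ne.to_subtype
  have hbdd : ∀ y : S → ℝ, (∀ s, 0 ≤ y s) →
      BddBelow (Set.range fun x : 𝒳 => influence E y (x : S × T → ℝ)) := by
    rintro y hy
    refine ⟨0, ?_⟩
    rintro _ ⟨x, rfl⟩
    exact influence_nonneg hy (h𝒳 x x.2)
  refine ⟨convex_Ici (0 : S → ℝ), ?_⟩
  intro y hy z hz a b ha hb hab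
  refine le_ciInf fun x => le_trans (add_le_add ?_ ?_)
    ((concaveOn_influence fun e he => (h𝒳 x x.2 e he).1).2 hy hz ha hb hab)
  · exact smul_le_smul_of_nonneg_left (ciInf_le (hbdd y hy) x) ha
  · exact smul_le_smul_of_nonneg_left (ciInf_le (hbdd z hz) x) hb
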